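/- Fix μ > 0, γ ≥ 1 and 0 < α < 1. Suppose ξ ∈ ℝᴺ, ξ ≠ 0, with |ξ|^{1−α} < μ/(2√γ). Then both eigenvalues λ₊(ξ) and λ₋(ξ) are real and negative, and they satisfy λ₊(ξ) ≤ −(μ/2)|ξ|^α and −(2γ/μ)|ξ|^{2−α} ≤ λ₋(ξ) ≤ −(γ/μ)|ξ|^{2−α}. -/

import Mathlib

open MeasureTheory Real
open scoped FourierTransform Matrix

/-- The eigenvalue `λ₊(ξ) = (−μ|ξ|^α − √(μ²|ξ|^{2α} − 4γ|ξ|²))/2` (principal complex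
square root), written in terms of `r = |ξ|`. -/
noncomputable def lamPlus (μ γ α r : ℝ) : ℂ :=
  (-((μ * r ^ α : ℝ) : ℂ) -
      (((μ ^ 2 * r ^ (2 * α) - 4 * γ * r ^ 2 : ℝ) : ℂ)) ^ (1 / 2 : ℂ)) / 2

/-- The eigenvalue `λ₋(ξ) = (−μ|ξ|^α + √(μ²|ξ|^{2α} − 4γ|ξ|²))/2` (principal complex
square root), written in terms of `r = |ξ|`. -/
noncomputable def lamMinus (μ γ α r : ℝ) : ℂ :=
  (-((μ * r ^ α : ℝ) : ℂ) +
      (((μ ^ 2 * r ^ (2 * α) - 4 * γ * r ^ 2 : ℝ) : ℂ)) ^ (1 / 2 : ℂ)) / 2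

/-- The matrix `A(ξ) = [[0, −|ξ|], [γ|ξ|, −μ|ξ|^α]]`, written in terms of `r = |ξ|`. -/
noncomputable def matA (μ γ α r : ℝ) : Matrix (Fin 2) (Fin 2) ℂ :=
  !![0, -(r : ℂ); (γ : ℂ) * (r : ℂ), -((μ * r ^ α : ℝ) : ℂ)]

/-- The Green matrix `Ĝ(t, ξ)`, written in terms of `r = |ξ|`: when `λ₊ ≠ λ₋` it is
`(λ₊ − λ₋)⁻¹ [[λ₊e^{tλ₋} − λ₋e^{tλ₊}, |ξ|(e^{tλ₋} − e^{tλ₊})],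
[γ|ξ|(e^{tλ₊} − e^{tλ₋}), λ₊e^{tλ₊} − λ₋e^{tλ₋}]]`, and when `λ₊ = λ₋` it is
`e^{−√γ|ξ|t} [[1 + √γ|ξ|t, −|ξ|t], [γ|ξ|t, 1 − √γ|ξ|t]]`. -/
noncomputable def Ghat (μ γ α t r : ℝ) : Matrix (Fin 2) (Fin 2) ℂ :=
  if lamPlus μ γ α r = lamMinus μ γ α r then
    Complex.exp (-(Real.sqrt γ * r * t)) •
      !![1 + ((Real.sqrt γ * r * t : ℝ) : ℂ), -((r * t : ℝ) : ℂ);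
         ((γ * r * t : ℝ) : ℂ), 1 - ((Real.sqrt γ * r * t : ℝ) : ℂ)]
  else
    (lamPlus μ γ α r - lamMinus μ γ α r)⁻¹ •
      !![lamPlus μ γ α r * Complex.exp ((t : ℂ) * lamMinus μ γ α r) -
           lamMinus μ γ α r * Complex.exp ((t : ℂ) * lamPlus μ γ α r),
         (r : ℂ) * (Complex.exp ((t : ℂ) * lamMinus μ γ α r) -
           Complex.exp ((t : ℂ) * lamPlus μ γ α r));
         (γ : ℂ) * (r : ℂ) * (Complex.exp ((t : ℂ) * lamPlus μ γ α r) -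
           Complex.exp ((t : ℂ) * lamMinus μ γ α r)),
         lamPlus μ γ α r * Complex.exp ((t : ℂ) * lamPlus μ γ α r) -
           lamMinus μ γ α r * Complex.exp ((t : ℂ) * lamMinus μ γ α r)]

/-- The principal complex square root of a nonnegative real number is its real square root. -/
theorem ofReal_cpow_half {x : ℝ} (hx : 0 ≤ x) : (x : ℂ) ^ (1 / 2 : ℂ) = (√x : ℂ) := by
  rw [Real.sqrt_eq_rpow, Complex.ofReal_cpow hx]
  norm_num

theorem lamPlus_eq_ofReal {μ γ α r : ℝ} (h : 0 ≤ μ ^ 2 * r ^ (2 * α) - 4 * γ * r ^ 2) :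
    lamPlus μ γ α r =
      (((-(μ * r ^ α) - √(μ ^ 2 * r ^ (2 * α) - 4 * γ * r ^ 2)) / 2 : ℝ) : ℂ) := by
  rw [lamPlus, ofReal_cpow_half h]
  push_cast
  rfl

theorem lamMinus_eq_ofReal {μ γ α r : ℝ} (h : 0 ≤ μ ^ 2 * r ^ (2 * α) - 4 * γ * r ^ 2) :
    lamMinus μ γ α r =
      (((-(μ * r ^ α) + √(μ ^ 2 * r ^ (2 * α) - 4 * γ * r ^ 2)) / 2 : ℝ) : ℂ) := by
  rw [lamMinus, ofReal_cpow_half h]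
  push_cast
  rfl

/-- The discriminant is `|ξ|^{2α} (μ² − 4γ|ξ|^{2(1−α)})`. -/
theorem discriminant_eq {μ γ α r : ℝ} (hr : 0 < r) :
    μ ^ 2 * r ^ (2 * α) - 4 * γ * r ^ 2 =
      (r ^ α) ^ 2 * (μ ^ 2 - 4 * γ * (r ^ (1 - α)) ^ 2) := by
  have h1 : r ^ (2 * α) = (r ^ α) ^ 2 := by
    rw [mul_comm, Real.rpow_mul hr.le, Real.rpow_two]
  have h2 : r = r ^ α * r ^ (1 - α) := by
    rw [← Real.rpow_add hr, add_sub_cancel, Real.rpow_one]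
  have h3 : r ^ 2 = (r ^ α) ^ 2 * (r ^ (1 - α)) ^ 2 := by
    rw [← mul_pow, ← h2]
  rw [h1, h3]
  ring

/-- In the low-frequency regime `|ξ|^{1−α} < μ/(2√γ)` (with `0 < α < 1`), the eigenvalues
`λ₊(ξ)` and `λ₋(ξ)` are real and negative, with `λ₊ ≤ −(μ/2)|ξ|^α` and
`−(2γ/μ)|ξ|^{2−α} ≤ λ₋ ≤ −(γ/μ)|ξ|^{2−α}`. -/
theorem eigenvalues_low_frequency (N : ℕ) (μ γ α : ℝ) (hμ : 0 < μ) (hγ : 1 ≤ γ)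
    (hα0 : 0 < α) (hα1 : α < 1) (ξ : EuclideanSpace ℝ (Fin N)) (hξ : ξ ≠ 0)
    (hlow : ‖ξ‖ ^ (1 - α) < μ / (2 * Real.sqrt γ)) :
    ((lamPlus μ γ α ‖ξ‖).im = 0 ∧ (lamPlus μ γ α ‖ξ‖).re < 0) ∧
    ((lamMinus μ γ α ‖ξ‖).im = 0 ∧ (lamMinus μ γ α ‖ξ‖).re < 0) ∧
    (lamPlus μ γ α ‖ξ‖).re ≤ -(μ / 2) * ‖ξ‖ ^ α ∧
    -(2 * γ / μ) * ‖ξ‖ ^ (2 - α) ≤ (lamMinus μ γ α ‖ξ‖).re ∧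
    (lamMinus μ γ α ‖ξ‖).re ≤ -(γ / μ) * ‖ξ‖ ^ (2 - α) := by
  have hr : 0 < ‖ξ‖ := norm_pos_iff.mpr hξ
  generalize ‖ξ‖ = r at hr hlow ⊢
  have ha : 0 < r ^ α := Real.rpow_pos_of_pos hr α
  have hb : 0 < r ^ (1 - α) := Real.rpow_pos_of_pos hr _
  have hγ0 : 0 < γ := by linarith
  have hsub : r ^ (2 - α) = r ^ α * (r ^ (1 - α)) ^ 2 := by
    rw [← Real.rpow_two, ← Real.rpow_mul hr.le, ← Real.rpow_add hr]
    congr 1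
    ring
  have hgap : 0 < μ ^ 2 - 4 * γ * (r ^ (1 - α)) ^ 2 := by
    rw [lt_div_iff₀ (by positivity)] at hlow
    have := pow_lt_pow_left₀ hlow (by positivity) two_ne_zero
    rw [mul_pow, mul_pow, Real.sq_sqrt hγ0.le] at this
    linarith
  have hdisc : 0 ≤ μ ^ 2 * r ^ (2 * α) - 4 * γ * r ^ 2 := by
    rw [discriminant_eq hr]
    positivity
  rw [lamPlus_eq_ofReal hdisc, lamMinus_eq_ofReal hdisc, discriminant_eq hr,
    Real.sqrt_mul (sq_nonneg _), Real.sqrt_sq ha.le, hsub]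
  simp only [Complex.ofReal_im, Complex.ofReal_re, true_and]
  generalize r ^ α = a at ha
  generalize r ^ (1 - α) = b at hb hgap
  have hq : 0 < √(μ ^ 2 - 4 * γ * b ^ 2) := Real.sqrt_pos.mpr hgap
  have hq2 := Real.sq_sqrt hgap.le
  generalize √(μ ^ 2 - 4 * γ * b ^ 2) = q at hq hq2
  have hγb : 0 < γ * b ^ 2 := by positivity
  have hqμ : q < μ := lt_of_pow_lt_pow_left₀ 2 hμ.le (by linarith)
  have haq : 0 < a * q := mul_pos ha hq
  have haμ : 0 < a * (μ - q) := mul_pos ha (sub_pos.mpr hqμ)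
  have hprod : 4 * (γ * b ^ 2) = (μ - q) * (μ + q) := by linarith
  have hlower : -(2 * γ / μ) * (a * b ^ 2) = -(a * (μ - q)) * (μ + q) / (2 * μ) := by
    field_simp
    linear_combination -hprod
  have hupper : -(γ / μ) * (a * b ^ 2) = -(a * (μ - q)) * (μ + q) / (4 * μ) := by
    field_simp
    linear_combination -hprod
  refine ⟨by nlinarith, by linarith, by linarith, ?_, ?_⟩
  · rw [hlower, div_le_iff₀ (by positivity)]
    nlinarith [mul_pos haμ hq]
  · rw [hupper, le_div_iff₀ (by positivity)]
    nlinarith [mul_pos haμ (sub_pos.mpr hqμ)]
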